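/- Let (Z,A,S) be a normal bivariate Birkhoff interpolation scheme in which Z is (p,q)-rectangular. If (Z,A,S) is regular, then the univariate scheme (Z_x, A_x, S_x) is regular. -/

import Mathlib

open Finset

/-- A finite subset of `ℤ≥0²` is a *lower set* if it is closed under
coordinatewise decrease. -/
def IsLower (S : Finset (ℕ × ℕ)) : Prop :=
  ∀ u v, (u, v) ∈ S → ∀ i j, i ≤ u → j ≤ v → (i, j) ∈ S

/-- The value at `(x,y)` of `∂^{i+j}P/∂x^i∂y^j`, where `P` is the polynomial
with coefficients `a` supported on `S`. -/
noncomputable def derivAt (S : Finset (ℕ × ℕ)) (a : ℕ × ℕ → ℝ) (i j : ℕ) (x y : ℝ) : ℝ :=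
  ∑ uv ∈ S, a uv * (uv.1.descFactorial i : ℝ) * (uv.2.descFactorial j : ℝ) *
      x ^ (uv.1 - i) * y ^ (uv.2 - j)

/-- The bivariate Birkhoff scheme `(Z,A,S)` is *regular*: every interpolation
problem has a unique solution in `P_S` (polynomials supported on `S`). -/
def Regular (Z : Finset (ℝ × ℝ)) (A S : Finset (ℕ × ℕ)) : Prop :=
  ∀ c : ℕ × ℕ → ℝ × ℝ → ℝ, ∃! a : ℕ × ℕ → ℝ,
    (∀ uv, uv ∉ S → a uv = 0) ∧
    ∀ z ∈ Z, ∀ ij ∈ A, derivAt S a ij.1 ij.2 z.1 z.2 = c ij z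

/-- The scheme `(Z,A,S)` is *solvable*: every interpolation problem has at
least one solution in `P_S`. -/
def Solvable (Z : Finset (ℝ × ℝ)) (A S : Finset (ℕ × ℕ)) : Prop :=
  ∀ c : ℕ × ℕ → ℝ × ℝ → ℝ, ∃ a : ℕ × ℕ → ℝ,
    (∀ uv, uv ∉ S → a uv = 0) ∧
    ∀ z ∈ Z, ∀ ij ∈ A, derivAt S a ij.1 ij.2 z.1 z.2 = c ij z

/-- `Z ⊂ ℝ²` is a `(p,q)`-rectangular set of nodes. -/
def IsRect (p q : ℕ) (Z : Finset (ℝ × ℝ)) : Prop :=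
  ∃ x : Fin (p + 1) → ℝ, ∃ y : Fin (q + 1) → ℝ,
    Function.Injective x ∧ Function.Injective y ∧
    Z = (Finset.univ : Finset (Fin (p + 1) × Fin (q + 1))).image (fun ij => (x ij.1, y ij.2))

/-- `B_x = {i : (i,0) ∈ B}`. -/
def setX (B : Finset (ℕ × ℕ)) : Finset ℕ := (B.filter fun ij => ij.2 = 0).image Prod.fst

/-- `B_y = {j : (0,j) ∈ B}`. -/
def setY (B : Finset (ℕ × ℕ)) : Finset ℕ := (B.filter fun ij => ij.1 = 0).image Prod.snd

/-- `B_x[β] = {α : (α,β) ∈ B}`. -/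
def sliceX (B : Finset (ℕ × ℕ)) (b : ℕ) : Finset ℕ := (B.filter fun ij => ij.2 = b).image Prod.fst

/-- `B_y[α] = {β : (α,β) ∈ B}`. -/
def sliceY (B : Finset (ℕ × ℕ)) (a : ℕ) : Finset ℕ := (B.filter fun ij => ij.1 = a).image Prod.snd

/-- Projection of the nodes on the OX axis. -/
noncomputable def nodesX (Z : Finset (ℝ × ℝ)) : Finset ℝ := Z.image Prod.fst

/-- Projection of the nodes on the OY axis. -/
noncomputable def nodesY (Z : Finset (ℝ × ℝ)) : Finset ℝ := Z.image Prod.snd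

/-- The rectangle `R(u,v) = {(i,j) : i ≤ u, j ≤ v}`. -/
def rect (u v : ℕ) : Finset (ℕ × ℕ) := Finset.range (u + 1) ×ˢ Finset.range (v + 1)

/-- The blow-up `R^{p,q} = {(α,β) : (⌊α/(p+1)⌋, ⌊β/(q+1)⌋) ∈ R}`. -/
def blowup (p q : ℕ) (R : Finset (ℕ × ℕ)) : Finset (ℕ × ℕ) :=
  (R ×ˢ (Finset.range (p + 1) ×ˢ Finset.range (q + 1))).image
    (fun x => ((p + 1) * x.1.1 + x.2.1, (q + 1) * x.1.2 + x.2.2))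

/-- `n_{p,q}(L)`: number of `(α,β) ∈ L` with `(p+1) ∣ α` and `(q+1) ∣ β`. -/
def npq (p q : ℕ) (L : Finset (ℕ × ℕ)) : ℕ :=
  (L.filter fun ab => (p + 1) ∣ ab.1 ∧ (q + 1) ∣ ab.2).card

/-- Value at `x` of the `i`-th derivative of the univariate polynomial with
coefficients `a` supported on `S`. -/
noncomputable def derivAt1 (S : Finset ℕ) (a : ℕ → ℝ) (i : ℕ) (x : ℝ) : ℝ :=
  ∑ u ∈ S, a u * (u.descFactorial i : ℝ) * x ^ (u - i)

/-- Regularity of the univariate Birkhoff scheme `(W,A,S)`. -/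
def Regular1 (W : Finset ℝ) (A S : Finset ℕ) : Prop :=
  ∀ c : ℕ → ℝ → ℝ, ∃! a : ℕ → ℝ,
    (∀ u, u ∉ S → a u = 0) ∧
    ∀ w ∈ W, ∀ i ∈ A, derivAt1 S a i w = c i w

/-- `(A,S)` is almost regular with respect to `(p,q)`-rectangular sets of nodes. -/
def AlmostRegular (p q : ℕ) (A S : Finset (ℕ × ℕ)) : Prop :=
  ∃ Z : Finset (ℝ × ℝ), IsRect p q Z ∧ Regular Z A S


/-- Membership in the projection `B_x`. -/
lemma mem_setX {B : Finset (ℕ × ℕ)} {i : ℕ} : i ∈ setX B ↔ (i, 0) ∈ B := by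
  simp [setX]

/-- The coefficients of `P(x)` viewed as a bivariate polynomial constant in `y`. -/
def constInY (a : ℕ → ℝ) (uv : ℕ × ℕ) : ℝ := if uv.2 = 0 then a uv.1 else 0

/-- The coefficients of the univariate polynomial `P(x, y)` obtained by fixing `y`. -/
noncomputable def restrictY (S : Finset (ℕ × ℕ)) (a : ℕ × ℕ → ℝ) (y : ℝ) (u : ℕ) : ℝ :=
  ∑ uv ∈ S with uv.1 = u, a uv * y ^ uv.2

lemma derivAt_constInY (S : Finset (ℕ × ℕ)) (a : ℕ → ℝ) (i j : ℕ) (x y : ℝ) :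
    derivAt S (constInY a) i j x y = if j = 0 then derivAt1 (setX S) a i x else 0 := by
  have hinj : Set.InjOn Prod.fst (S.filter fun uv => uv.2 = 0 : Set (ℕ × ℕ)) := by
    rintro ⟨u, v⟩ h ⟨u', v'⟩ h' huu
    simp_all
  have key : derivAt S (constInY a) i j x y = ∑ uv ∈ S.filter (fun uv => uv.2 = 0),
      a uv.1 * (uv.1.descFactorial i : ℝ) * x ^ (uv.1 - i) * (Nat.descFactorial 0 j : ℝ) := by
    rw [derivAt, Finset.sum_filter]
    refine Finset.sum_congr rfl fun uv _ => ?_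
    by_cases h : uv.2 = 0
    · simp only [constInY, h, if_true, Nat.zero_sub, pow_zero]
      ring
    · simp [constInY, h]
  rw [key]
  rcases j with _ | j
  · rw [if_pos rfl, derivAt1, setX, Finset.sum_image hinj]
    simp
  · simp

lemma derivAt1_restrictY {S : Finset (ℕ × ℕ)} (hS : IsLower S) (a : ℕ × ℕ → ℝ)
    (i : ℕ) (x y : ℝ) :
    derivAt1 (setX S) (restrictY S a y) i x = derivAt S a i 0 x y := by
  have hmaps : ∀ uv ∈ S, uv.1 ∈ setX S := fun uv h =>
    mem_setX.2 (hS uv.1 uv.2 h _ _ le_rfl (Nat.zero_le _))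
  rw [derivAt, ← Finset.sum_fiberwise_of_maps_to hmaps, derivAt1]
  refine Finset.sum_congr rfl fun u _ => ?_
  rw [restrictY, Finset.sum_mul, Finset.sum_mul]
  refine Finset.sum_congr rfl fun uv huv => ?_
  obtain rfl := (Finset.mem_filter.1 huv).2
  simp only [Nat.descFactorial_zero, Nat.cast_one, Nat.sub_zero]
  ring

lemma restrictY_eq_zero {S : Finset (ℕ × ℕ)} (hS : IsLower S) (a : ℕ × ℕ → ℝ) (y : ℝ)
    {u : ℕ} (hu : u ∉ setX S) : restrictY S a y u = 0 := by
  refine Finset.sum_eq_zero fun uv huv => absurd ?_ hu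
  obtain ⟨h, rfl⟩ := Finset.mem_filter.1 huv
  exact mem_setX.2 (hS uv.1 uv.2 h _ _ le_rfl (Nat.zero_le _))

/-- If `P(x)` solves a univariate problem, then `P`, viewed as constant in `y`, solves the
bivariate problem whose data vanish for derivatives of positive order in `y`. -/
lemma constInY_solves {Z : Finset (ℝ × ℝ)} {A S : Finset (ℕ × ℕ)} {c : ℕ → ℝ → ℝ} {a : ℕ → ℝ}
    (ha : (∀ u, u ∉ setX S → a u = 0) ∧
      ∀ w ∈ nodesX Z, ∀ i ∈ setX A, derivAt1 (setX S) a i w = c i w) :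
    (∀ uv, uv ∉ S → constInY a uv = 0) ∧
      ∀ z ∈ Z, ∀ ij ∈ A, derivAt S (constInY a) ij.1 ij.2 z.1 z.2 =
        if ij.2 = 0 then c ij.1 z.1 else 0 := by
  refine ⟨?_, ?_⟩
  · rintro ⟨u, v⟩ huv
    unfold constInY
    split_ifs with hv
    · obtain rfl : v = 0 := hv
      exact ha.1 u fun h => huv (mem_setX.1 h)
    · rfl
  · rintro z hz ⟨i, j⟩ hij
    rw [derivAt_constInY]
    split_ifs with hj
    · obtain rfl : j = 0 := hj
      exact ha.2 z.1 (Finset.mem_image_of_mem _ hz) i (mem_setX.2 hij)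
    · rfl

/-- regularity of `(Z,A,S)` with `(p,q)`-rectangular nodes forces
regularity of the univariate scheme `(Z_x, A_x, S_x)`. -/
theorem univariate_x_regular (p q : ℕ) (Z : Finset (ℝ × ℝ)) (A S : Finset (ℕ × ℕ))
    (hZ : IsRect p q Z) (hS : IsLower S) (hnorm : S.card = Z.card * A.card)
    (hreg : Regular Z A S) :
    Regular1 (nodesX Z) (setX A) (setX S) := by
  intro c
  obtain ⟨x, y, -, -, rfl⟩ := hZ
  obtain ⟨a, ⟨-, ha⟩, huniq⟩ := hreg fun ij z => if ij.2 = 0 then c ij.1 z.1 else 0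
  refine ⟨restrictY S a (y 0), ⟨fun u hu => restrictY_eq_zero hS a _ hu, ?_⟩, ?_⟩
  · intro w hw i hi
    obtain ⟨k, rfl⟩ : ∃ k, x k = w := by simpa [nodesX] using hw
    rw [derivAt1_restrictY hS]
    have h := ha (x k, y 0) (Finset.mem_image.2 ⟨(k, 0), Finset.mem_univ _, rfl⟩) (i, 0)
      (mem_setX.1 hi)
    simpa using h
  · intro b hb
    obtain rfl := huniq _ (constInY_solves hb)
    funext u
    by_cases hu : u ∈ setX S
    · rw [restrictY, Finset.sum_eq_single (u, 0)]
      · simp [constInY]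
      · rintro ⟨u', v⟩ h hne
        obtain rfl : u' = u := (Finset.mem_filter.1 h).2
        have hv : v ≠ 0 := by rintro rfl; exact hne rfl
        simp [constInY, hv]
      · intro h
        exact absurd (by simpa using mem_setX.1 hu) h
    · rw [hb.1 u hu, restrictY_eq_zero hS _ _ hu]
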